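/- Let G and V_1, …, V_m be random variables on a finite probability space taking values in finite types, assume V_1, …, V_m are mutually conditionally independent given G, and let Z be one of the V_i (say Z = V_j for some fixed index j). For each i, let q_i be any probability mass function on the value type of V_i with q_i(v) > 0 whenever the marginal mass of V_i at v is positive. Then I(Z; G) ≤ Σ_{i=1}^m Σ_{v,g} p(V_i = v, G = g) log( p(V_i = v | G = g) / q_i(v) ). (This is the second upper bound, Eq. (10)–(13), of the paper's Proposition 2: the mutual information between the final-layer representation and the observed graph is bounded by the sum over layers of the variational EIB and XIB terms; here the layer variables Z^{(1)},…,Z^{(L)}, E^{(1)},…,E^{(L)} are the V_i and Z^{(L)} is Z.) -/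

import Mathlib

open scoped BigOperators

/-- Joint/marginal probability mass of a random variable `X` on a finite space with
probability mass function `p`. -/
noncomputable def massOf {Ω : Type*} [Fintype Ω] (p : Ω → ℝ)
    {A : Type*} [DecidableEq A] (X : Ω → A) (x : A) : ℝ :=
  ∑ ω, if X ω = x then p ω else 0

/-- Joint probability mass of a pair of random variables. -/
noncomputable def massOf2 {Ω : Type*} [Fintype Ω] (p : Ω → ℝ)
    {A B : Type*} [DecidableEq A] [DecidableEq B] (X : Ω → A) (Z : Ω → B) (x : A) (z : B) : ℝ :=
  ∑ ω, if X ω = x ∧ Z ω = z then p ω else 0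

/-- Joint probability mass of a triple of random variables. -/
noncomputable def massOf3 {Ω : Type*} [Fintype Ω] (p : Ω → ℝ)
    {A B C : Type*} [DecidableEq A] [DecidableEq B] [DecidableEq C]
    (X : Ω → A) (Z : Ω → B) (W : Ω → C) (x : A) (z : B) (w : C) : ℝ :=
  ∑ ω, if X ω = x ∧ Z ω = z ∧ W ω = w then p ω else 0

/-- Shannon entropy `H(X)`. -/
noncomputable def entropy {Ω : Type*} [Fintype Ω] (p : Ω → ℝ)
    {A : Type*} [Fintype A] [DecidableEq A] (X : Ω → A) : ℝ :=
  -∑ x, massOf p X x * Real.log (massOf p X x)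

/-- Conditional Shannon entropy `H(X|Z)`. -/
noncomputable def condEntropy {Ω : Type*} [Fintype Ω] (p : Ω → ℝ)
    {A B : Type*} [Fintype A] [DecidableEq A] [Fintype B] [DecidableEq B]
    (X : Ω → A) (Z : Ω → B) : ℝ :=
  -∑ x, ∑ z, massOf2 p X Z x z * Real.log (massOf2 p X Z x z / massOf p Z z)

/-- Mutual information `I(X;Z)` (terms with zero probability vanish since they are
multiplied by the zero mass). -/
noncomputable def mutInfo {Ω : Type*} [Fintype Ω] (p : Ω → ℝ)
    {A B : Type*} [Fintype A] [DecidableEq A] [Fintype B] [DecidableEq B]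
    (X : Ω → A) (Z : Ω → B) : ℝ :=
  ∑ x, ∑ z, massOf2 p X Z x z *
    Real.log (massOf2 p X Z x z / (massOf p X x * massOf p Z z))

/-- Conditional mutual information `I(X;Z|W)`, using
`p(x,z|w)/(p(x|w)p(z|w)) = p(x,z,w)p(w)/(p(x,w)p(z,w))`. -/
noncomputable def condMutInfo {Ω : Type*} [Fintype Ω] (p : Ω → ℝ)
    {A B C : Type*} [Fintype A] [DecidableEq A] [Fintype B] [DecidableEq B]
    [Fintype C] [DecidableEq C] (X : Ω → A) (Z : Ω → B) (W : Ω → C) : ℝ :=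
  ∑ x, ∑ z, ∑ w, massOf3 p X Z W x z w *
    Real.log ((massOf3 p X Z W x z w * massOf p W w) /
      (massOf2 p X W x w * massOf2 p Z W z w))

/-- `X` and `Z` are independent: `p(x,z) = p(x) p(z)`. -/
def IndepRV {Ω : Type*} [Fintype Ω] (p : Ω → ℝ)
    {A B : Type*} [DecidableEq A] [DecidableEq B] (X : Ω → A) (Z : Ω → B) : Prop :=
  ∀ x z, massOf2 p X Z x z = massOf p X x * massOf p Z z

/-- `X` and `Z` are conditionally independent given `W`:
`p(x,z,w) p(w) = p(x,w) p(z,w)`. -/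
def CondIndepRV {Ω : Type*} [Fintype Ω] (p : Ω → ℝ)
    {A B C : Type*} [DecidableEq A] [DecidableEq B] [DecidableEq C]
    (X : Ω → A) (Z : Ω → B) (W : Ω → C) : Prop :=
  ∀ x z w, massOf3 p X Z W x z w * massOf p W w = massOf2 p X W x w * massOf2 p Z W z w

/-- The **Gibbs inequality**, in unnormalized form. -/
theorem sum_mul_log_div_nonneg {ι : Type*} [Fintype ι] (a b : ι → ℝ)
    (ha : ∀ i, 0 ≤ a i) (hb : ∀ i, 0 ≤ b i) (hab : ∀ i, 0 < a i → 0 < b i)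
    (hsum : ∑ i, b i ≤ ∑ i, a i) : 0 ≤ ∑ i, a i * Real.log (a i / b i) := by
  have key : ∀ i, a i - b i ≤ a i * Real.log (a i / b i) := by
    intro i
    rcases (ha i).eq_or_lt with h | h
    · simp [← h, hb i]
    · have h1 := mul_le_mul_of_nonneg_left
        (Real.one_sub_inv_le_log_of_pos (div_pos h (hab i h))) h.le
      have h2 : a i * (1 - (a i / b i)⁻¹) = a i - b i := by
        field_simp
      rwa [h2] at h1
  calc (0 : ℝ) ≤ ∑ i, (a i - b i) := by
        rw [Finset.sum_sub_distrib]; linarith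
    _ ≤ _ := Finset.sum_le_sum fun i _ => key i

section Mass

variable {Ω : Type*} [Fintype Ω] {p : Ω → ℝ} {A B : Type*} [DecidableEq A] [DecidableEq B]

theorem massOf_nonneg (hp0 : ∀ ω, 0 ≤ p ω) (X : Ω → A) (x : A) : 0 ≤ massOf p X x :=
  Finset.sum_nonneg fun ω _ => by split_ifs <;> simp [hp0 ω]

theorem massOf2_nonneg (hp0 : ∀ ω, 0 ≤ p ω) (X : Ω → A) (Z : Ω → B) (x : A) (z : B) :
    0 ≤ massOf2 p X Z x z :=
  Finset.sum_nonneg fun ω _ => by split_ifs <;> simp [hp0 ω]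

theorem massOf2_le_left (hp0 : ∀ ω, 0 ≤ p ω) (X : Ω → A) (Z : Ω → B) (x : A) (z : B) :
    massOf2 p X Z x z ≤ massOf p X x :=
  Finset.sum_le_sum fun ω _ => by
    have := hp0 ω
    split_ifs <;> simp_all

theorem massOf2_le_right (hp0 : ∀ ω, 0 ≤ p ω) (X : Ω → A) (Z : Ω → B) (x : A) (z : B) :
    massOf2 p X Z x z ≤ massOf p Z z :=
  Finset.sum_le_sum fun ω _ => by
    have := hp0 ω
    split_ifs <;> simp_all

theorem sum_massOf [Fintype A] (X : Ω → A) : ∑ x, massOf p X x = ∑ ω, p ω := by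
  simp only [massOf]
  rw [Finset.sum_comm]
  simp

theorem sum_massOf2_right [Fintype B] (X : Ω → A) (Z : Ω → B) (x : A) :
    ∑ z, massOf2 p X Z x z = massOf p X x := by
  simp only [massOf, massOf2]
  rw [Finset.sum_comm]
  refine Finset.sum_congr rfl fun ω _ => ?_
  by_cases h : X ω = x <;> simp [h]

variable [Fintype A] [Fintype B]

/-- The variational rate `∑ p(x,z) log (p(x|z) / q(x))` is nonnegative. -/
theorem variational_rate_nonneg (hp0 : ∀ ω, 0 ≤ p ω) (X : Ω → A) (Z : Ω → B) (q : A → ℝ)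
    (hq0 : ∀ x, 0 ≤ q x) (hq1 : ∑ x, q x = 1) (hqpos : ∀ x, 0 < massOf p X x → 0 < q x) :
    0 ≤ ∑ x, ∑ z, massOf2 p X Z x z *
      Real.log ((massOf2 p X Z x z / massOf p Z z) / q x) := by
  have h := sum_mul_log_div_nonneg (fun y : A × B => massOf2 p X Z y.1 y.2)
    (fun y => massOf p Z y.2 * q y.1)
    (fun y => massOf2_nonneg hp0 X Z y.1 y.2)
    (fun y => mul_nonneg (massOf_nonneg hp0 Z y.2) (hq0 y.1))
    (fun y hy => mul_pos (hy.trans_le (massOf2_le_right hp0 X Z y.1 y.2))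
      (hqpos y.1 (hy.trans_le (massOf2_le_left hp0 X Z y.1 y.2))))
    (by
      simp only [Fintype.sum_prod_type, sum_massOf2_right, sum_massOf, ← Finset.sum_mul,
        ← Finset.mul_sum, hq1, mul_one, le_refl])
  simpa only [Fintype.sum_prod_type, div_div] using h

/-- The variational rate `∑ p(x,z) log (p(x|z) / q(x))` bounds the mutual information. -/
theorem mutInfo_le_variational_rate (hp0 : ∀ ω, 0 ≤ p ω) (hp1 : ∑ ω, p ω = 1)
    (X : Ω → A) (Z : Ω → B) (q : A → ℝ)
    (hq0 : ∀ x, 0 ≤ q x) (hq1 : ∑ x, q x = 1) (hqpos : ∀ x, 0 < massOf p X x → 0 < q x) :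
    mutInfo p X Z ≤ ∑ x, ∑ z, massOf2 p X Z x z *
      Real.log ((massOf2 p X Z x z / massOf p Z z) / q x) := by
  have h := sum_mul_log_div_nonneg (massOf p X) q (massOf_nonneg hp0 X) hq0 hqpos
    (by rw [sum_massOf, hp1, hq1])
  have hdecomp : ∑ x, ∑ z, massOf2 p X Z x z *
        Real.log ((massOf2 p X Z x z / massOf p Z z) / q x) =
      mutInfo p X Z + ∑ x, massOf p X x * Real.log (massOf p X x / q x) := by
    rw [mutInfo, ← Finset.sum_add_distrib]
    refine Finset.sum_congr rfl fun x _ => ?_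
    rw [← sum_massOf2_right X Z x, Finset.sum_mul, ← Finset.sum_add_distrib,
      sum_massOf2_right X Z x]
    refine Finset.sum_congr rfl fun z _ => ?_
    rcases (massOf2_nonneg hp0 X Z x z).eq_or_lt with h0 | h0
    · simp [← h0]
    · have hX := h0.trans_le (massOf2_le_left hp0 X Z x z)
      have hZ := h0.trans_le (massOf2_le_right hp0 X Z x z)
      have hq := hqpos x hX
      rw [← mul_add, ← Real.log_mul (by positivity) (by positivity)]
      congr 2
      field_simp
  linarith

end Mass

/-- **Proposition 2, Eqs. (10)–(13).** If the layer variables `V_1, …, V_m` are mutually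
conditionally independent given `G` and `Z = V_j` is one of them, then for any family of
pmfs `q_i` positive wherever the corresponding marginal is,
`I(Z;G) ≤ Σ_i Σ_{v,g} p(V_i = v, G = g) log(p(V_i = v | G = g) / q_i(v))`. -/
theorem mutInfo_le_sum_variational_layers
    {Ω : Type*} [Fintype Ω] (p : Ω → ℝ)
    (hp0 : ∀ ω, 0 ≤ p ω) (hp1 : ∑ ω, p ω = 1)
    {m : ℕ} {A : Fin m → Type*} [∀ i, Fintype (A i)] [∀ i, DecidableEq (A i)]
    {𝒢 : Type*} [Fintype 𝒢] [DecidableEq 𝒢]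
    (V : ∀ i, Ω → A i) (G : Ω → 𝒢) (j : Fin m)
    (hCI : ∀ g, 0 < massOf p G g → ∀ v : ∀ i, A i,
      massOf2 p (fun ω i => V i ω) G v g / massOf p G g =
        ∏ i, massOf2 p (V i) G (v i) g / massOf p G g)
    (q : ∀ i, A i → ℝ)
    (hq0 : ∀ i v, 0 ≤ q i v) (hq1 : ∀ i, ∑ v, q i v = 1)
    (hqpos : ∀ i v, 0 < massOf p (V i) v → 0 < q i v) :
    mutInfo p (V j) G ≤
      ∑ i, ∑ v, ∑ g, massOf2 p (V i) G v g *
        Real.log ((massOf2 p (V i) G v g / massOf p G g) / q i v) := by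
  exact (mutInfo_le_variational_rate hp0 hp1 (V j) G (q j) (hq0 j) (hq1 j) (hqpos j)).trans
    (Finset.single_le_sum (f := fun i => ∑ v, ∑ g, massOf2 p (V i) G v g *
        Real.log ((massOf2 p (V i) G v g / massOf p G g) / q i v))
      (fun i _ => variational_rate_nonneg hp0 (V i) G (q i) (hq0 i) (hq1 i) (hqpos i))
      (Finset.mem_univ j))
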